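/- arXiv:2507.02420 — 6 statements merged into one kernel-verified Lean document; each statement's English description precedes it below -/
import Mathlib

section
/- Let b ≥ 2 be an integer and W a b × b unitary complex matrix. Then for every n ≥ 0 and all j, k ∈ {0, …, bⁿ−1}, ∫₀¹ conj(f_j^{(bⁿ)}(x)) · f_k^{(bⁿ)}(x) dx = δ_{jk} / bⁿ, where δ_{jk} is the Kronecker delta. -/
open MeasureTheory Finset

/-- The GTT basis functions `f_j^{(bⁿ)} : [0,1) → ℂ` (extended by `0` outside `[0,1)`),
defined recursively: `f_0^{(1)}(x) = 1` for `0 ≤ x < 1`, and for `n ≥ 1`,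
`f_j^{(bⁿ)}(x) = W ⌊bx⌋ ⌊j/b^{n-1}⌋ * f_{j mod b^{n-1}}^{(b^{n-1})}({bx})`. -/
noncomputable def gtt (b : ℕ) (W : ℕ → ℕ → ℂ) : ℕ → ℕ → ℝ → ℂ
  | 0, _, x => if 0 ≤ x ∧ x < 1 then 1 else 0
  | n + 1, j, x =>
    if 0 ≤ x ∧ x < 1 then
      W (⌊(b : ℝ) * x⌋).toNat (j / b ^ n) *
        gtt b W n (j % b ^ n) (Int.fract ((b : ℝ) * x))
    else 0


lemma gtt_piece (b : ℕ) (hb : 2 ≤ b) (A : ℕ → ℂ) (F G : ℝ → ℂ)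
    (hF : ∀ x : ℝ, 0 < x → x < 1 →
      F x = A (⌊(b : ℝ) * x⌋).toNat * G (Int.fract ((b : ℝ) * x)))
    (hG : IntervalIntegrable G volume 0 1) :
    IntervalIntegrable F volume 0 1 ∧
      (∫ x in (0:ℝ)..1, F x) =
        (b : ℂ)⁻¹ * ((∑ m ∈ Finset.range b, A m) * ∫ x in (0:ℝ)..1, G x) := by
  have hb0 : (b : ℝ) ≠ 0 := by
    have : b ≠ 0 := by omega
    exact_mod_cast this
  set H : ℝ → ℂ := fun y => A (⌊y⌋).toNat * G (Int.fract y) with hH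
  have hpiece : ∀ m : ℕ, Set.EqOn (fun y : ℝ => A m * G (y - m)) H
      (Set.uIoo (m : ℝ) ((m + 1 : ℕ) : ℝ)) := by
    intro m y hy
    rw [Set.uIoo_of_le (by push_cast; linarith)] at hy
    have h1 : ⌊y⌋ = (m : ℤ) := by
      rw [Int.floor_eq_iff]
      have h2 := hy.2
      push_cast at h2 ⊢
      exact ⟨hy.1.le, h2⟩
    have h3 : Int.fract y = y - m := by
      have h4 := Int.self_sub_floor y
      rw [h1] at h4
      simpa using h4.symm
    simp [hH, h3, h1]
  have hint : ∀ m < b, IntervalIntegrable H volume ((fun k : ℕ => (k : ℝ)) m)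
      ((fun k : ℕ => (k : ℝ)) (m + 1)) := by
    intro m _
    refine IntervalIntegrable.congr_uIoo ?_ (hpiece m)
    have h := (hG.comp_sub_right (m : ℝ)).const_mul (A m)
    simpa [add_comm] using h
  have hHint : IntervalIntegrable H volume 0 b := by
    simpa using IntervalIntegrable.trans_iterate hint
  have hFH : Set.EqOn (fun x => H ((b : ℝ) * x)) F (Set.uIoo (0:ℝ) 1) := by
    intro x hx
    rw [Set.uIoo_of_le zero_le_one] at hx
    exact (hF x hx.1 hx.2).symm
  constructor
  · refine IntervalIntegrable.congr_uIoo ?_ hFH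
    have h := hHint.comp_mul_left (c := (b : ℝ))
    simpa [hb0] using h
  · rw [← intervalIntegral.integral_congr_uIoo hFH,
      intervalIntegral.integral_comp_mul_left H hb0]
    have hs := intervalIntegral.sum_integral_adjacent_intervals hint
    simp only [Nat.cast_zero] at hs
    rw [mul_zero, mul_one, ← hs, Finset.sum_mul, Complex.real_smul]
    push_cast
    congr 1
    refine Finset.sum_congr rfl fun m _ => ?_
    have h := intervalIntegral.integral_congr_uIoo (μ := volume) (hpiece m)
    push_cast at h
    rw [← h, intervalIntegral.integral_const_mul, intervalIntegral.integral_comp_sub_right]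
    simp

lemma gtt_aux
    (b : ℕ) (hb : 2 ≤ b) (W : ℕ → ℕ → ℂ)
    (hW : ∀ j < b, ∀ k < b,
      (∑ m ∈ Finset.range b, star (W m j) * W m k) = if j = k then 1 else 0)
    (n : ℕ) :
    ∀ j < b ^ n, ∀ k < b ^ n,
      IntervalIntegrable (fun x => star (gtt b W n j x) * gtt b W n k x) volume 0 1 ∧
      (∫ x in (0:ℝ)..1, star (gtt b W n j x) * gtt b W n k x)
        = (if j = k then (1 : ℂ) else 0) / ((b : ℂ) ^ n) := by
  induction n with
  | zero =>
    intro j hj k hk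
    have hj0 : j = 0 := by simpa using hj
    have hk0 : k = 0 := by simpa using hk
    subst hj0 hk0
    have he : Set.EqOn (fun _ : ℝ => (1 : ℂ))
        (fun x => star (gtt b W 0 0 x) * gtt b W 0 0 x) (Set.uIoo (0:ℝ) 1) := by
      intro x hx
      rw [Set.uIoo_of_le zero_le_one] at hx
      simp [gtt, hx.1.le, hx.2]
    refine ⟨IntervalIntegrable.congr_uIoo (by simp) he, ?_⟩
    rw [← intervalIntegral.integral_congr_uIoo he]
    simp
  | succ n ih =>
    intro j hj k hk
    have hp : 0 < b ^ n := by positivity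
    have hjd : j / b ^ n < b := by
      rw [Nat.div_lt_iff_lt_mul hp]; rwa [pow_succ, mul_comm] at hj
    have hkd : k / b ^ n < b := by
      rw [Nat.div_lt_iff_lt_mul hp]; rwa [pow_succ, mul_comm] at hk
    obtain ⟨hI, hE⟩ := ih (j % b ^ n) (Nat.mod_lt _ hp) (k % b ^ n) (Nat.mod_lt _ hp)
    obtain ⟨h1, h2⟩ := gtt_piece b hb
      (fun m => star (W m (j / b ^ n)) * W m (k / b ^ n))
      (fun x => star (gtt b W (n + 1) j x) * gtt b W (n + 1) k x) _
      (by
        intro x hx0 hx1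
        simp only [gtt, hx0.le, hx1, and_self, if_true, star_mul]
        ring) hI
    refine ⟨h1, ?_⟩
    rw [h2, hE, hW _ hjd _ hkd]
    have hjk : j = k ↔ j / b ^ n = k / b ^ n ∧ j % b ^ n = k % b ^ n := by
      constructor
      · rintro rfl; simp
      · rintro ⟨h3, h4⟩
        rw [← Nat.div_add_mod j (b ^ n), h3, h4, Nat.div_add_mod]
    by_cases h3 : j / b ^ n = k / b ^ n <;> by_cases h4 : j % b ^ n = k % b ^ n <;>
      simp [hjk, h3, h4, pow_succ, mul_comm]

/-- for `b ≥ 2` and `W` unitary, for every `n ≥ 0` and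
`j, k ∈ {0,…,bⁿ−1}`, `∫₀¹ conj (f_j^{(bⁿ)} x) * f_k^{(bⁿ)} x dx = δ_{jk} / bⁿ`. -/
theorem gtt_orthogonality
    (b : ℕ) (hb : 2 ≤ b) (W : ℕ → ℕ → ℂ)
    (hW : ∀ j < b, ∀ k < b,
      (∑ m ∈ Finset.range b, star (W m j) * W m k) = if j = k then 1 else 0)
    (n : ℕ) :
    ∀ j < b ^ n, ∀ k < b ^ n,
      (∫ x in (0:ℝ)..1, star (gtt b W n j x) * gtt b W n k x)
        = (if j = k then (1 : ℂ) else 0) / ((b : ℂ) ^ n) := by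
  exact fun j hj k hk => (gtt_aux b hb W hW n j hj k hk).2
end

section
/- Let b ≥ 2 be an integer and W a b × b unitary complex matrix. Define the normalized GTT basis functions φ_j^{(bⁿ)}(x) = b^{n/2} · f_j^{(bⁿ)}(x). Then for every n ≥ 0, the family {φ_j^{(bⁿ)}}_{j=0}^{bⁿ−1} is orthonormal in L²[0,1): for all j, k ∈ {0,…,bⁿ−1}, ∫₀¹ conj(φ_j^{(bⁿ)}(x)) · φ_k^{(bⁿ)}(x) dx = δ_{jk}. -/
open MeasureTheory Finset

/-- The normalized GTT basis functions `φ_j^{(bⁿ)} = b^{n/2} · f_j^{(bⁿ)}`. -/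
noncomputable def gttNorm (b : ℕ) (W : ℕ → ℕ → ℂ) (n j : ℕ) (x : ℝ) : ℂ :=
  (Real.sqrt ((b : ℝ) ^ n) : ℂ) * gtt b W n j x

/-- Self-similar integration: a function that on each `(m/b, (m+1)/b)` is a rescaled copy
of `G m` integrates to the average of the integrals of `G m`. -/
theorem gtt_aux_selfsim (b : ℕ) (hb : 0 < b) (G : ℕ → ℝ → ℂ) (H : ℝ → ℂ)
    (hG : ∀ m < b, IntervalIntegrable (G m) volume 0 1)
    (hH : ∀ m < b, ∀ x : ℝ, (m : ℝ) < b * x → (b : ℝ) * x < m + 1 → H x = G m (b * x - m)) :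
    IntervalIntegrable H volume 0 1 ∧
      (∫ x in (0:ℝ)..1, H x) = (b : ℂ)⁻¹ * ∑ m ∈ Finset.range b, ∫ y in (0:ℝ)..1, G m y := by
  have hb0 : (0 : ℝ) < b := by exact_mod_cast hb
  have hEq : ∀ m < b, Set.EqOn (fun x => G m (b * x - m)) H
      (Set.uIoo ((m : ℝ) / b) (((m + 1 : ℕ) : ℝ) / b)) := by
    intro m hm x hx
    have hle : (m : ℝ) / b ≤ ((m + 1 : ℕ) : ℝ) / b := by
      gcongr
      simp
    rw [Set.uIoo_of_le hle] at hx
    obtain ⟨h1, h2⟩ := hx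
    rw [div_lt_iff₀ hb0, mul_comm] at h1
    rw [lt_div_iff₀ hb0, mul_comm] at h2
    push_cast at h2
    exact (hH m hm x h1 h2).symm
  have hint : ∀ m < b, IntervalIntegrable H volume ((m : ℝ) / b) (((m + 1 : ℕ) : ℝ) / b) := by
    intro m hm
    refine IntervalIntegrable.congr_uIoo ?_ (hEq m hm)
    have h1 := (hG m hm).comp_sub_right (m : ℝ)
    have h2 := h1.comp_mul_left (c := (b : ℝ))
    convert h2 using 2
    · simp
    · push_cast
      ring
  have hbb : (b : ℝ) / b = 1 := div_self hb0.ne'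
  constructor
  · have := IntervalIntegrable.trans_iterate (a := fun m : ℕ => (m : ℝ) / b) hint
    simpa [hbb] using this
  · have := intervalIntegral.sum_integral_adjacent_intervals
      (a := fun m : ℕ => (m : ℝ) / b) hint
    simp only [Nat.cast_zero, zero_div, hbb] at this
    rw [← this, Finset.mul_sum]
    refine Finset.sum_congr rfl fun m hm => ?_
    have hm' := Finset.mem_range.mp hm
    rw [← intervalIntegral.integral_congr_uIoo (hEq m hm'),
      intervalIntegral.integral_comp_mul_sub (G m) hb0.ne']
    have e1 : (b : ℝ) * (m / b) - m = 0 := by field_simp; ring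
    have e2 : (b : ℝ) * (((m + 1 : ℕ) : ℝ) / b) - m = 1 := by
      push_cast; field_simp; ring
    rw [e1, e2, Complex.real_smul]
    push_cast
    rfl

theorem gtt_aux_succ (b : ℕ) (W : ℕ → ℕ → ℂ) (n j m : ℕ) (hm : m < b) (x : ℝ)
    (h1 : (m : ℝ) < b * x) (h2 : (b : ℝ) * x < m + 1) :
    gtt b W (n + 1) j x = W m (j / b ^ n) * gtt b W n (j % b ^ n) (b * x - m) := by
  have hb0 : (0 : ℝ) < b := by exact_mod_cast (Nat.zero_le m).trans_lt hm
  have hm1 : (m : ℝ) + 1 ≤ b := by exact_mod_cast hm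
  have hm0 : (0 : ℝ) ≤ m := by positivity
  have hx0 : 0 ≤ x := by
    by_contra h
    push Not at h
    nlinarith
  have hx1 : x < 1 := by
    by_contra h
    push Not at h
    nlinarith
  have hfl : ⌊(b : ℝ) * x⌋ = (m : ℤ) := by
    rw [Int.floor_eq_iff]
    push_cast
    exact ⟨h1.le, h2⟩
  rw [gtt, if_pos ⟨hx0, hx1⟩, Int.fract, hfl]
  simp

theorem gtt_aux_main (b : ℕ) (hb : 2 ≤ b) (W : ℕ → ℕ → ℂ)
    (hW : ∀ j < b, ∀ k < b,
      (∑ m ∈ Finset.range b, star (W m j) * W m k) = if j = k then 1 else 0)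
    (n : ℕ) :
    ∀ j < b ^ n, ∀ k < b ^ n,
      IntervalIntegrable (fun x => star (gtt b W n j x) * gtt b W n k x) volume 0 1 ∧
      (∫ x in (0:ℝ)..1, star (gtt b W n j x) * gtt b W n k x)
        = if j = k then ((b : ℂ) ^ n)⁻¹ else 0 := by
  induction n with
  | zero =>
    intro j hj k hk
    have hE : Set.EqOn (fun _ : ℝ => (1 : ℂ))
        (fun x => star (gtt b W 0 j x) * gtt b W 0 k x) (Set.uIoo (0:ℝ) 1) := by
      intro x hx
      rw [Set.uIoo_of_le zero_le_one] at hx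
      simp [gtt, hx.1.le, hx.2]
    refine ⟨IntervalIntegrable.congr_uIoo (by simp) hE, ?_⟩
    rw [← intervalIntegral.integral_congr_uIoo hE]
    have : j = k := by simp at hj hk; omega
    simp [this]
  | succ n ih =>
    intro j hj k hk
    have hbn : 0 < b ^ n := by positivity
    have hj1 : j / b ^ n < b := Nat.div_lt_of_lt_mul (by rwa [pow_succ] at hj)
    have hk1 : k / b ^ n < b := Nat.div_lt_of_lt_mul (by rwa [pow_succ] at hk)
    obtain ⟨I, hI⟩ := ih (j % b ^ n) (Nat.mod_lt _ hbn) (k % b ^ n) (Nat.mod_lt _ hbn)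
    have key := gtt_aux_selfsim b (by omega)
      (fun m y => (star (W m (j / b ^ n)) * W m (k / b ^ n)) *
        (star (gtt b W n (j % b ^ n) y) * gtt b W n (k % b ^ n) y))
      (fun x => star (gtt b W (n + 1) j x) * gtt b W (n + 1) k x)
      (fun m _ => I.const_mul _)
      (by
        intro m hm x h1 h2
        simp only [gtt_aux_succ b W n _ m hm x h1 h2, star_mul']
        ring)
    refine ⟨key.1, ?_⟩
    rw [key.2]
    simp only [intervalIntegral.integral_const_mul]
    rw [← Finset.sum_mul, hW _ hj1 _ hk1, hI]
    have hjk : j = k ↔ j / b ^ n = k / b ^ n ∧ j % b ^ n = k % b ^ n := by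
      constructor
      · rintro rfl
        exact ⟨rfl, rfl⟩
      · rintro ⟨h1, h2⟩
        rw [← Nat.div_add_mod j (b ^ n), h1, h2, Nat.div_add_mod]
    by_cases h1 : j / b ^ n = k / b ^ n <;> by_cases h2 : j % b ^ n = k % b ^ n <;>
      simp [hjk, h1, h2, pow_succ, mul_comm]

/-- for `b ≥ 2` and `W` unitary, for every `n ≥ 0` the normalized
GTT basis functions `φ_j^{(bⁿ)} = b^{n/2} f_j^{(bⁿ)}`, `j = 0,…,bⁿ−1`, are
orthonormal in `L²[0,1)`:
`∫₀¹ conj (φ_j^{(bⁿ)} x) * φ_k^{(bⁿ)} x dx = δ_{jk}`. -/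
theorem gtt_normalized_orthonormal
    (b : ℕ) (hb : 2 ≤ b) (W : ℕ → ℕ → ℂ)
    (hW : ∀ j < b, ∀ k < b,
      (∑ m ∈ Finset.range b, star (W m j) * W m k) = if j = k then 1 else 0)
    (n : ℕ) :
    ∀ j < b ^ n, ∀ k < b ^ n,
      (∫ x in (0:ℝ)..1, star (gttNorm b W n j x) * gttNorm b W n k x)
        = if j = k then (1 : ℂ) else 0 := by
  intro j hj k hk
  have h := (gtt_aux_main b hb W hW n j hj k hk).2
  have hb0 : (b : ℂ) ^ n ≠ 0 := pow_ne_zero _ (by norm_cast; omega)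
  have hs : ((Real.sqrt ((b : ℝ) ^ n) : ℝ) : ℂ) * (Real.sqrt ((b : ℝ) ^ n) : ℝ) = (b : ℂ) ^ n := by
    rw [← Complex.ofReal_mul, Real.mul_self_sqrt (by positivity)]
    push_cast
    rfl
  have hf : ∀ x, star (gttNorm b W n j x) * gttNorm b W n k x
      = (b : ℂ) ^ n * (star (gtt b W n j x) * gtt b W n k x) := by
    intro x
    have hc : star ((Real.sqrt ((b : ℝ) ^ n) : ℝ) : ℂ) = (Real.sqrt ((b : ℝ) ^ n) : ℝ) :=
      Complex.conj_ofReal _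
    rw [← hs]
    simp only [gttNorm, star_mul', hc]
    ring
  simp only [hf]
  rw [intervalIntegral.integral_const_mul, h]
  split_ifs
  · exact mul_inv_cancel₀ hb0
  · simp
end

section
/- Let b ≥ 2 be an integer, W a b × b unitary complex matrix, n ≥ 1, and N = bⁿ. Define the N × N matrix G_N by G_N(p, q) = f_q^{(N)}((2p+1)/(2N)) for p, q ∈ {0,…,N−1}. Then G_N is unitary: G_N† G_N = I. -/
open MeasureTheory Finset Matrix

theorem gtt_aux_sum (a c : ℕ) (f : ℕ → ℂ) :
    ∑ p ∈ Finset.range (a * c), f p =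
      ∑ m ∈ Finset.range a, ∑ r ∈ Finset.range c, f (m * c + r) := by
  induction a with
  | zero => simp
  | succ a ih => rw [Nat.succ_mul, Finset.sum_range_add, ih, Finset.sum_range_succ]

theorem gtt_aux_step (b : ℕ) (hb : 2 ≤ b) (W : ℕ → ℕ → ℂ) (n j m r : ℕ)
    (hm : m < b) (hr : r < b ^ n) :
    gtt b W (n + 1) j ((2 * ((m * b ^ n + r : ℕ) : ℝ) + 1) / (2 * (b : ℝ) ^ (n + 1))) =
      W m (j / b ^ n) * gtt b W n (j % b ^ n) ((2 * (r : ℝ) + 1) / (2 * (b : ℝ) ^ n)) := by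
  have hb0 : (0 : ℝ) < b := by exact_mod_cast (by omega : 0 < b)
  have hN : (0 : ℝ) < (b : ℝ) ^ n := by positivity
  have hr' : (r : ℝ) + 1 ≤ (b : ℝ) ^ n := by exact_mod_cast hr
  have hm' : (m : ℝ) + 1 ≤ b := by exact_mod_cast hm
  set y : ℝ := (2 * (r : ℝ) + 1) / (2 * (b : ℝ) ^ n) with hy
  have hy0 : 0 ≤ y := by positivity
  have hy1 : y < 1 := by
    rw [hy, div_lt_one (by positivity)]
    linarith
  set x : ℝ := (2 * ((m * b ^ n + r : ℕ) : ℝ) + 1) / (2 * (b : ℝ) ^ (n + 1)) with hx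
  have hbx : (b : ℝ) * x = m + y := by
    rw [hx, hy]
    push_cast
    field_simp
    ring
  have hx0 : 0 ≤ x := by positivity
  have hx1 : x < 1 := by
    by_contra h
    have h1 : (b : ℝ) * 1 ≤ b * x := mul_le_mul_of_nonneg_left (not_lt.mp h) hb0.le
    linarith
  have hfl : ⌊(m : ℝ) + y⌋ = (m : ℤ) := by
    rw [Int.floor_eq_iff]
    push_cast
    constructor <;> linarith
  have hfr : Int.fract ((m : ℝ) + y) = y := by
    rw [Int.fract, hfl]
    push_cast
    ring
  rw [gtt, if_pos ⟨hx0, hx1⟩, hbx, hfl, hfr, Int.toNat_natCast]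

theorem gtt_aux_orth (b : ℕ) (hb : 2 ≤ b) (W : ℕ → ℕ → ℂ)
    (hW : ∀ j < b, ∀ k < b,
      (∑ m ∈ Finset.range b, star (W m j) * W m k) = if j = k then 1 else 0)
    (n : ℕ) : ∀ j < b ^ n, ∀ k < b ^ n,
      (∑ p ∈ Finset.range (b ^ n),
        star (gtt b W n j ((2 * (p : ℝ) + 1) / (2 * (b : ℝ) ^ n))) *
          gtt b W n k ((2 * (p : ℝ) + 1) / (2 * (b : ℝ) ^ n))) = if j = k then 1 else 0 := by
  induction n with
  | zero =>
    intro j hj k hk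
    have hj : j = 0 := by simpa using hj
    have hk : k = 0 := by simpa using hk
    subst hj hk
    have h : (2 : ℝ)⁻¹ < 1 := by norm_num
    simp [gtt, h]
  | succ n ih =>
    intro j hj k hk
    have hN : 0 < b ^ n := by positivity
    have hj1 : j / b ^ n < b := Nat.div_lt_of_lt_mul (by rwa [← pow_succ])
    have hk1 : k / b ^ n < b := Nat.div_lt_of_lt_mul (by rwa [← pow_succ])
    have key : (∑ p ∈ Finset.range (b ^ (n + 1)),
        star (gtt b W (n + 1) j ((2 * (p : ℝ) + 1) / (2 * (b : ℝ) ^ (n + 1)))) *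
          gtt b W (n + 1) k ((2 * (p : ℝ) + 1) / (2 * (b : ℝ) ^ (n + 1)))) =
        (∑ m ∈ Finset.range b, star (W m (j / b ^ n)) * W m (k / b ^ n)) *
        (∑ p ∈ Finset.range (b ^ n),
          star (gtt b W n (j % b ^ n) ((2 * (p : ℝ) + 1) / (2 * (b : ℝ) ^ n))) *
          gtt b W n (k % b ^ n) ((2 * (p : ℝ) + 1) / (2 * (b : ℝ) ^ n))) := by
      have e : b ^ (n + 1) = b * b ^ n := by ring
      rw [e, gtt_aux_sum, Finset.sum_mul_sum]
      refine Finset.sum_congr rfl fun m hm => Finset.sum_congr rfl fun r hr => ?_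
      rw [Finset.mem_range] at hm hr
      rw [gtt_aux_step b hb W n j m r hm hr, gtt_aux_step b hb W n k m r hm hr, star_mul]
      ring
    rw [key, hW _ hj1 _ hk1, ih _ (Nat.mod_lt _ hN) _ (Nat.mod_lt _ hN)]
    by_cases h : j = k
    · subst h; simp
    · rw [if_neg h]
      by_cases h1 : j / b ^ n = k / b ^ n
      · have h2 : j % b ^ n ≠ k % b ^ n := by
          intro h2
          apply h
          rw [← Nat.div_add_mod j (b ^ n), ← Nat.div_add_mod k (b ^ n), h1, h2]
        rw [if_neg h2, mul_zero]
      · rw [if_neg h1, zero_mul]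

/-- with `N = bⁿ`, the `N × N` matrix `G_N (p, q) = f_q^{(N)}((2p+1)/(2N))`
obtained by sampling the GTT basis functions at subinterval midpoints is unitary:
`G_N† G_N = I`. -/
theorem gtt_sampled_matrix_unitary
    (b : ℕ) (hb : 2 ≤ b) (W : ℕ → ℕ → ℂ)
    (hW : ∀ j < b, ∀ k < b,
      (∑ m ∈ Finset.range b, star (W m j) * W m k) = if j = k then 1 else 0)
    (n : ℕ) (hn : 1 ≤ n)
    (G : Matrix (Fin (b ^ n)) (Fin (b ^ n)) ℂ)
    (hG : ∀ p q : Fin (b ^ n),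
      G p q = gtt b W n (q : ℕ) ((2 * ((p : ℕ) : ℝ) + 1) / (2 * (b : ℝ) ^ n))) :
    Gᴴ * G = 1 := by
  ext j k
  rw [Matrix.mul_apply, Matrix.one_apply]
  have h := gtt_aux_orth b hb W hW n j j.2 k k.2
  rw [← Fin.sum_univ_eq_sum_range (fun p : ℕ =>
    star (gtt b W n j ((2 * (p : ℝ) + 1) / (2 * (b : ℝ) ^ n))) *
      gtt b W n k ((2 * (p : ℝ) + 1) / (2 * (b : ℝ) ^ n)))] at h
  simp only [Matrix.conjTranspose_apply, hG, Fin.ext_iff]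
  exact h
end

section
/- Let b ≥ 2 be an integer, W a b × b complex matrix, and n ≥ 1. Let p, j ∈ {0,…,bⁿ−1} have base-b digit expansions p = Σ_{m=0}^{n−1} p_m bᵐ and j = Σ_{m=0}^{n−1} j_m bᵐ with digits p_m, j_m ∈ {0,…,b−1}. Then for every x ∈ [p/bⁿ, (p+1)/bⁿ), the GTT basis function satisfies the closed form f_j^{(bⁿ)}(x) = ∏_{m=0}^{n−1} W_{p_m, j_m}. In particular each f_j^{(bⁿ)} is constant on every subinterval [p/bⁿ, (p+1)/bⁿ). -/
open Finset

theorem gtt_digit_aux (b p n m : ℕ) (h : m < n) :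
    (p % b ^ n) / b ^ m % b = p / b ^ m % b := by
  rw [← Nat.mod_mul_right_div_self, ← Nat.mod_mul_right_div_self, ← pow_succ,
    Nat.mod_mod_of_dvd _ (pow_dvd_pow b h)]

theorem gtt_closed_form_aux (b : ℕ) (hb : 2 ≤ b) (W : ℕ → ℕ → ℂ) (n : ℕ) :
    ∀ p < b ^ n, ∀ j < b ^ n, ∀ x : ℝ,
      ((p : ℝ) / (b : ℝ) ^ n ≤ x) → (x < ((p : ℝ) + 1) / (b : ℝ) ^ n) →
      gtt b W n j x = ∏ m ∈ Finset.range n, W ((p / b ^ m) % b) ((j / b ^ m) % b) := by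
  induction n with
  | zero =>
    intro p hp j hj x h1 h2
    have : p = 0 := by simpa using hp
    subst this
    simp at h1 h2
    simp [gtt, h1, h2]
  | succ n ih =>
    intro p hp j hj x h1 h2
    have hb0 : (0 : ℝ) < b := by exact_mod_cast (by omega : 0 < b)
    have hBn : 0 < b ^ n := pow_pos (by omega) n
    have hB : (0 : ℝ) < (b : ℝ) ^ n := pow_pos hb0 n
    have hB1 : (0 : ℝ) < (b : ℝ) ^ (n + 1) := pow_pos hb0 _
    have hx0 : 0 ≤ x := le_trans (by positivity) h1
    have hx1 : x < 1 := by
      refine lt_of_lt_of_le h2 ?_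
      rw [div_le_one hB1]
      exact_mod_cast hp
    rw [div_le_iff₀ hB1, pow_succ] at h1
    rw [lt_div_iff₀ hB1, pow_succ] at h2
    have hdec : (p : ℝ) = (b : ℝ) ^ n * ((p / b ^ n : ℕ) : ℝ) + ((p % b ^ n : ℕ) : ℝ) := by
      exact_mod_cast (Nat.div_add_mod p (b ^ n)).symm
    have hr : ((p % b ^ n : ℕ) : ℝ) + 1 ≤ (b : ℝ) ^ n := by
      exact_mod_cast Nat.mod_lt p hBn
    have hr0 : (0 : ℝ) ≤ ((p % b ^ n : ℕ) : ℝ) := Nat.cast_nonneg _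
    have e1 : ((p % b ^ n : ℕ) : ℝ) / (b : ℝ) ^ n ≤ b * x - ((p / b ^ n : ℕ) : ℝ) := by
      rw [div_le_iff₀ hB]; linarith
    have e2 : b * x - ((p / b ^ n : ℕ) : ℝ) < (((p % b ^ n : ℕ) : ℝ) + 1) / (b : ℝ) ^ n := by
      rw [lt_div_iff₀ hB]; linarith
    have e3 : (0 : ℝ) ≤ ((p % b ^ n : ℕ) : ℝ) / (b : ℝ) ^ n := by positivity
    have e4 : (((p % b ^ n : ℕ) : ℝ) + 1) / (b : ℝ) ^ n ≤ 1 := by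
      rw [div_le_one hB]; exact hr
    have hfl : ⌊(b : ℝ) * x⌋ = ((p / b ^ n : ℕ) : ℤ) := by
      rw [Int.floor_eq_iff, Int.cast_natCast]
      constructor <;> linarith
    have hfr : Int.fract ((b : ℝ) * x) = b * x - ((p / b ^ n : ℕ) : ℝ) := by
      rw [Int.fract, hfl, Int.cast_natCast]
    have hpd : p / b ^ n < b := Nat.div_lt_of_lt_mul (by rwa [← pow_succ])
    have hjd : j / b ^ n < b := Nat.div_lt_of_lt_mul (by rwa [← pow_succ])
    rw [gtt, if_pos ⟨hx0, hx1⟩, hfr, hfl, Int.toNat_natCast,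
      ih _ (Nat.mod_lt p hBn) _ (Nat.mod_lt j hBn) _ e1 e2, Finset.prod_range_succ,
      Nat.mod_eq_of_lt hpd, Nat.mod_eq_of_lt hjd, mul_comm]
    congr 1
    refine Finset.prod_congr rfl fun m hm => ?_
    rw [gtt_digit_aux _ _ _ _ (Finset.mem_range.mp hm),
      gtt_digit_aux _ _ _ _ (Finset.mem_range.mp hm)]

/-- closed form of the GTT basis functions. For `p, j < bⁿ` with
base-`b` digits `p_m = (p / bᵐ) % b` and `j_m = (j / bᵐ) % b`, and every
`x ∈ [p/bⁿ, (p+1)/bⁿ)`, we have `f_j^{(bⁿ)}(x) = ∏_{m<n} W (p_m) (j_m)`.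
In particular each `f_j^{(bⁿ)}` is constant on every subinterval `[p/bⁿ, (p+1)/bⁿ)`. -/
theorem gtt_closed_form
    (b : ℕ) (hb : 2 ≤ b) (W : ℕ → ℕ → ℂ) (n : ℕ) (hn : 1 ≤ n) :
    ∀ p < b ^ n, ∀ j < b ^ n, ∀ x : ℝ,
      ((p : ℝ) / (b : ℝ) ^ n ≤ x) → (x < ((p : ℝ) + 1) / (b : ℝ) ^ n) →
      gtt b W n j x = ∏ m ∈ Finset.range n, W ((p / b ^ m) % b) ((j / b ^ m) % b) := by
  exact gtt_closed_form_aux b hb W n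
end

section
/- Let b ≥ 2 be an integer, W a b × b unitary complex matrix, n ≥ 1, and N = bⁿ. Then the sampled GTT matrix coincides with the n-fold Kronecker power of W: for all p, q ∈ {0,…,N−1}, f_q^{(N)}((2p+1)/(2N)) = (W^{⊗n})_{p,q}. -/
open Finset

/-- The `n`-fold Kronecker power of a `b × b` matrix `W` (entries indexed by ℕ),
defined recursively by `W^{⊗0} = (1×1 identity)` and `W^{⊗n} = W^{⊗(n−1)} ⊗ W`,
where `(A ⊗ B)_{(i b + k),(j b + l)} = A i j * B k l`. -/
def kronPow (b : ℕ) (W : ℕ → ℕ → ℂ) : ℕ → ℕ → ℕ → ℂ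
  | 0 => fun p q => if p = 0 ∧ q = 0 then 1 else 0
  | n + 1 => fun p q => kronPow b W n (p / b) (q / b) * W (p % b) (q % b)

theorem kronPow_succ_left (b : ℕ) (hb : 2 ≤ b) (W : ℕ → ℕ → ℂ) (n : ℕ) :
    ∀ p < b ^ (n + 1), ∀ q < b ^ (n + 1),
      kronPow b W (n + 1) p q =
        W (p / b ^ n) (q / b ^ n) * kronPow b W n (p % b ^ n) (q % b ^ n) := by
  induction n with
  | zero =>
    intro p hp q hq
    have hp' : p < b := by simpa using hp
    have hq' : q < b := by simpa using hq
    simp [kronPow, Nat.div_eq_of_lt hp', Nat.div_eq_of_lt hq', Nat.mod_eq_of_lt hp',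
      Nat.mod_eq_of_lt hq', Nat.mod_one]
  | succ n ih =>
    intro p hp q hq
    have h1 : ∀ r < b ^ (n + 1 + 1), r / b < b ^ (n + 1) := by
      intro r hr
      rw [Nat.div_lt_iff_lt_mul (by omega), ← pow_succ]
      exact hr
    have h2 : ∀ r, r % b ^ (n + 1) / b = r / b % b ^ n := by
      intro r
      rw [pow_succ', Nat.mod_mul_right_div_self]
    have h3 : ∀ r, r % b ^ (n + 1) % b = r % b := by
      intro r
      exact Nat.mod_mod_of_dvd _ (dvd_pow_self b (by omega))
    have h4 : ∀ r, r / b / b ^ n = r / b ^ (n + 1) := by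
      intro r
      rw [Nat.div_div_eq_div_mul, pow_succ']
    have e1 : kronPow b W (n + 1 + 1) p q
      = kronPow b W (n + 1) (p / b) (q / b) * W (p % b) (q % b) := rfl
    have e2 : kronPow b W (n + 1) (p % b ^ (n + 1)) (q % b ^ (n + 1))
      = kronPow b W n (p % b ^ (n + 1) / b) (q % b ^ (n + 1) / b)
        * W (p % b ^ (n + 1) % b) (q % b ^ (n + 1) % b) := rfl
    rw [e1, e2, ih _ (h1 p hp) _ (h1 q hq), h2, h2, h3, h3, h4, h4, mul_assoc]

theorem gtt_sampled_aux (b : ℕ) (hb : 2 ≤ b) (W : ℕ → ℕ → ℂ) (n : ℕ) :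
    ∀ p < b ^ n, ∀ q < b ^ n,
      gtt b W n q ((2 * (p : ℝ) + 1) / (2 * (b : ℝ) ^ n)) = kronPow b W n p q := by
  have hb0 : (0 : ℝ) < b := by
    have : 0 < b := by omega
    exact_mod_cast this
  have hx : ∀ m p : ℕ, p < b ^ m → 0 ≤ (2 * (p : ℝ) + 1) / (2 * (b : ℝ) ^ m) ∧
      (2 * (p : ℝ) + 1) / (2 * (b : ℝ) ^ m) < 1 := by
    intro m p hp
    refine ⟨by positivity, ?_⟩
    rw [div_lt_one (by positivity)]
    have : (p : ℝ) + 1 ≤ (b : ℝ) ^ m := by exact_mod_cast hp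
    linarith
  induction n with
  | zero =>
    intro p hp q hq
    have hp' : p = 0 := by simpa using hp
    have hq' : q = 0 := by simpa using hq
    subst hp' hq'
    have := hx 0 0 (by simp)
    rw [gtt, if_pos this]
    simp [kronPow]
  | succ n ih =>
    intro p hp q hq
    have hbn : 0 < b ^ n := pow_pos (by omega) n
    have key : (b : ℝ) * ((2 * (p : ℝ) + 1) / (2 * (b : ℝ) ^ (n + 1)))
        = ((p / b ^ n : ℕ) : ℤ) +
          (2 * ((p % b ^ n : ℕ) : ℝ) + 1) / (2 * (b : ℝ) ^ n) := by
      have hd : (p : ℝ) = (b : ℝ) ^ n * ((p / b ^ n : ℕ) : ℝ) + ((p % b ^ n : ℕ) : ℝ) := by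
        exact_mod_cast (Nat.div_add_mod p (b ^ n)).symm
      rw [Int.cast_natCast]
      generalize ((p / b ^ n : ℕ) : ℝ) = u at *
      generalize ((p % b ^ n : ℕ) : ℝ) = v at *
      rw [hd]
      field_simp
      ring
    have hm := hx n (p % b ^ n) (Nat.mod_lt _ hbn)
    have hfl : ⌊(b : ℝ) * ((2 * (p : ℝ) + 1) / (2 * (b : ℝ) ^ (n + 1)))⌋
        = ((p / b ^ n : ℕ) : ℤ) := by
      rw [key, Int.floor_intCast_add, Int.floor_eq_zero_iff.mpr hm, add_zero]
    have hfr : Int.fract ((b : ℝ) * ((2 * (p : ℝ) + 1) / (2 * (b : ℝ) ^ (n + 1))))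
        = (2 * ((p % b ^ n : ℕ) : ℝ) + 1) / (2 * (b : ℝ) ^ n) := by
      rw [key, Int.fract_intCast_add, Int.fract_eq_self.mpr hm]
    rw [gtt, if_pos (hx _ p hp), hfl, hfr, Int.toNat_natCast,
      ih _ (Nat.mod_lt _ hbn) _ (Nat.mod_lt _ hbn), kronPow_succ_left b hb W n p hp q hq]

/-- with `N = bⁿ`, the sampled GTT matrix coincides with the `n`-fold
Kronecker power of `W`: for all `p, q < N`,
`f_q^{(N)}((2p+1)/(2N)) = (W^{⊗n})_{p,q}`. -/
theorem gtt_sampled_eq_kronPow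
    (b : ℕ) (hb : 2 ≤ b) (W : ℕ → ℕ → ℂ)
    (hW : ∀ j < b, ∀ k < b,
      (∑ m ∈ Finset.range b, star (W m j) * W m k) = if j = k then 1 else 0)
    (n : ℕ) (hn : 1 ≤ n) :
    ∀ p < b ^ n, ∀ q < b ^ n,
      gtt b W n q ((2 * (p : ℝ) + 1) / (2 * (b : ℝ) ^ n)) = kronPow b W n p q := by
  exact gtt_sampled_aux b hb W n
end

section
/- Let b ≥ 2 be an integer, W a b × b unitary complex matrix, n ≥ 0, and N = bⁿ. Let g : [0,1) → ℂ be constant on each subinterval [p/N, (p+1)/N) for p ∈ {0,…,N−1}. Define the GTT-Fourier coefficients C_m = ∫₀¹ conj(φ_m^{(N)}(t)) · g(t) dt, where φ_m^{(N)} = b^{n/2} · f_m^{(N)} are the normalized GTT basis functions. Then g is exactly reconstructed by its GTT-Fourier series: for every x ∈ [0,1), g(x) = Σ_{m=0}^{N−1} C_m · φ_m^{(N)}(x). -/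
open MeasureTheory Finset

lemma gtt_sum_split (B : ℕ) (hB : 0 < B) (F G : ℕ → ℂ) (c : ℕ) :
    ∑ j ∈ Finset.range (B * c), F (j / B) * G (j % B)
      = (∑ k ∈ Finset.range c, F k) * ∑ i ∈ Finset.range B, G i := by
  induction c with
  | zero => simp
  | succ c ih =>
    rw [Nat.mul_succ, Finset.sum_range_add, ih, Finset.sum_range_succ, add_mul]
    congr 1
    rw [Finset.mul_sum]
    refine Finset.sum_congr rfl fun i hi => ?_
    have hi' := Finset.mem_range.1 hi
    rw [Nat.mul_add_div hB, Nat.div_eq_of_lt hi', Nat.mul_add_mod, Nat.mod_eq_of_lt hi']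
    simp

lemma gtt_row_orth (b : ℕ) (W : ℕ → ℕ → ℂ)
    (hW : ∀ j < b, ∀ k < b,
      (∑ m ∈ Finset.range b, star (W m j) * W m k) = if j = k then 1 else 0)
    (u v : ℕ) (hu : u < b) (hv : v < b) :
    ∑ k ∈ Finset.range b, star (W u k) * W v k = if u = v then 1 else 0 := by
  let A : Matrix (Fin b) (Fin b) ℂ := fun i j => W i j
  have h1 : A.conjTranspose * A = 1 := by
    ext i j
    rw [Matrix.mul_apply, Matrix.one_apply]
    have := hW i i.2 j j.2
    rw [Finset.sum_range] at this
    simp only [Fin.ext_iff]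
    exact this
  have h2 : A * A.conjTranspose = 1 := mul_eq_one_comm.1 h1
  have h3 := congrFun (congrFun h2 ⟨v, hv⟩) ⟨u, hu⟩
  rw [Matrix.mul_apply, Matrix.one_apply] at h3
  rw [Finset.sum_range]
  simp only [Fin.mk.injEq] at h3
  simp only [mul_comm (star _)]
  refine Eq.trans h3 ?_
  simp [eq_comm]

lemma gtt_floor_bound (B : ℕ) (hB : 0 < B) (t : ℝ) (h0 : 0 ≤ t) (h1 : t < 1) :
    0 ≤ ⌊(B : ℝ) * t⌋ ∧ ⌊(B : ℝ) * t⌋ < (B : ℤ) := by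
  have : (0 : ℝ) < B := by exact_mod_cast hB
  refine ⟨Int.floor_nonneg.2 (by positivity), Int.floor_lt.2 ?_⟩
  push_cast
  nlinarith

lemma gtt_floor_succ (b n : ℕ) (t : ℝ) :
    ⌊((b ^ (n + 1) : ℕ) : ℝ) * t⌋ =
      ((b ^ n : ℕ) : ℤ) * ⌊(b : ℝ) * t⌋ + ⌊((b ^ n : ℕ) : ℝ) * Int.fract ((b : ℝ) * t)⌋ := by
  have : ((b ^ (n + 1) : ℕ) : ℝ) * t =
      ((((b ^ n : ℕ) : ℤ) * ⌊(b : ℝ) * t⌋ : ℤ) : ℝ) + ((b ^ n : ℕ) : ℝ) * Int.fract ((b : ℝ) * t) := by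
    rw [Int.fract]; push_cast; ring
  rw [this, Int.floor_intCast_add]

lemma gtt_floor_iff (b n : ℕ) (hb : 0 < b) (t x : ℝ) :
    ⌊((b ^ (n + 1) : ℕ) : ℝ) * t⌋ = ⌊((b ^ (n + 1) : ℕ) : ℝ) * x⌋ ↔
      ⌊(b : ℝ) * t⌋ = ⌊(b : ℝ) * x⌋ ∧
      ⌊((b ^ n : ℕ) : ℝ) * Int.fract ((b : ℝ) * t)⌋ =
        ⌊((b ^ n : ℕ) : ℝ) * Int.fract ((b : ℝ) * x)⌋ := by
  rw [gtt_floor_succ, gtt_floor_succ]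
  have hB : 0 < b ^ n := pow_pos hb n
  obtain ⟨a0, a1⟩ := gtt_floor_bound _ hB _ (Int.fract_nonneg ((b : ℝ) * t)) (Int.fract_lt_one _)
  obtain ⟨c0, c1⟩ := gtt_floor_bound _ hB _ (Int.fract_nonneg ((b : ℝ) * x)) (Int.fract_lt_one _)
  generalize ⌊((b ^ n : ℕ) : ℝ) * Int.fract ((b : ℝ) * t)⌋ = a at *
  generalize ⌊((b ^ n : ℕ) : ℝ) * Int.fract ((b : ℝ) * x)⌋ = c at *
  generalize ⌊(b : ℝ) * t⌋ = u
  generalize ⌊(b : ℝ) * x⌋ = v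
  have hB' : (0 : ℤ) < ((b ^ n : ℕ) : ℤ) := by exact_mod_cast hB
  generalize ((b ^ n : ℕ) : ℤ) = B at *
  constructor
  · intro h
    have huv : u = v := by
      have e1 : (B * u + a) / B = u := by
        rw [Int.mul_add_ediv_left _ _ hB'.ne', Int.ediv_eq_zero_of_lt a0 a1, add_zero]
      have e2 : (B * v + c) / B = v := by
        rw [Int.mul_add_ediv_left _ _ hB'.ne', Int.ediv_eq_zero_of_lt c0 c1, add_zero]
      rw [← e1, h, e2]
    subst huv
    exact ⟨rfl, by linarith⟩
  · rintro ⟨rfl, rfl⟩; rfl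

lemma gtt_kernel (b : ℕ) (hb : 2 ≤ b) (W : ℕ → ℕ → ℂ)
    (hW : ∀ j < b, ∀ k < b,
      (∑ m ∈ Finset.range b, star (W m j) * W m k) = if j = k then 1 else 0)
    (n : ℕ) : ∀ (t x : ℝ), 0 ≤ t → t < 1 → 0 ≤ x → x < 1 →
    ∑ m ∈ Finset.range (b ^ n), star (gtt b W n m t) * gtt b W n m x =
      if ⌊((b ^ n : ℕ) : ℝ) * t⌋ = ⌊((b ^ n : ℕ) : ℝ) * x⌋ then 1 else 0 := by
  induction n with
  | zero =>
    intro t x t0 t1 x0 x1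
    have ht : ⌊t⌋ = 0 := Int.floor_eq_zero_iff.2 ⟨t0, t1⟩
    have hx : ⌊x⌋ = 0 := Int.floor_eq_zero_iff.2 ⟨x0, x1⟩
    simp [gtt, t0, t1, x0, x1, ht, hx]
  | succ n ih =>
    intro t x t0 t1 x0 x1
    have hb0 : 0 < b := by omega
    obtain ⟨a0, a1⟩ := gtt_floor_bound b hb0 t t0 t1
    obtain ⟨c0, c1⟩ := gtt_floor_bound b hb0 x x0 x1
    have key := gtt_sum_split (b ^ n) (pow_pos hb0 n)
      (fun k => star (W (⌊(b : ℝ) * t⌋).toNat k) * W (⌊(b : ℝ) * x⌋).toNat k)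
      (fun i => star (gtt b W n i (Int.fract ((b : ℝ) * t))) *
        gtt b W n i (Int.fract ((b : ℝ) * x))) b
    rw [ih _ _ (Int.fract_nonneg _) (Int.fract_lt_one _) (Int.fract_nonneg _) (Int.fract_lt_one _),
      gtt_row_orth b W hW _ _ (by omega) (by omega), ← pow_succ] at key
    have e : ((⌊(b : ℝ) * t⌋).toNat = (⌊(b : ℝ) * x⌋).toNat) ↔ ⌊(b : ℝ) * t⌋ = ⌊(b : ℝ) * x⌋ := by
      omega
    rw [if_congr (gtt_floor_iff b n hb0 t x) rfl rfl]
    rw [if_congr e rfl rfl] at key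
    rw [show ∀ (P Q : Prop) [Decidable P] [Decidable Q], (if P ∧ Q then (1:ℂ) else 0) = (if P then 1 else 0) * (if Q then 1 else 0) from fun P Q _ _ => by split_ifs <;> simp_all, ← key]
    refine Finset.sum_congr rfl fun j _ => ?_
    simp only [gtt, t0, t1, x0, x1, and_self, if_true, star_mul']
    ring

lemma gtt_step (b : ℕ) (hb : 2 ≤ b) (W : ℕ → ℕ → ℂ) (n : ℕ) :
    ∀ (j : ℕ) (t x : ℝ), 0 ≤ t → t < 1 → 0 ≤ x → x < 1 →
    ⌊((b ^ n : ℕ) : ℝ) * t⌋ = ⌊((b ^ n : ℕ) : ℝ) * x⌋ → gtt b W n j t = gtt b W n j x := by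
  induction n with
  | zero => intro j t x t0 t1 x0 x1 _; simp [gtt, t0, t1, x0, x1]
  | succ n ih =>
    intro j t x t0 t1 x0 x1 h
    rw [gtt_floor_iff b n (by omega)] at h
    simp only [gtt, t0, t1, x0, x1, and_self, if_true]
    rw [h.1, ih _ _ _ (Int.fract_nonneg _) (Int.fract_lt_one _) (Int.fract_nonneg _)
      (Int.fract_lt_one _) h.2]

lemma gtt_integrable (N : ℕ) (hN : 0 < N) (h : ℝ → ℂ)
    (hh : ∀ t x : ℝ, 0 ≤ t → t < 1 → 0 ≤ x → x < 1 →
      ⌊(N : ℝ) * t⌋ = ⌊(N : ℝ) * x⌋ → h t = h x) :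
    IntegrableOn h (Set.Ico 0 1) := by
  have hN' : (0 : ℝ) < N := by exact_mod_cast hN
  let F : ℤ → ℂ := fun p => h ((p : ℝ) / N)
  have hF : ∀ t ∈ Set.Ico (0 : ℝ) 1, F ⌊(N : ℝ) * t⌋ = h t := by
    rintro t ⟨t0, t1⟩
    obtain ⟨a0, a1⟩ := gtt_floor_bound N hN t t0 t1
    have a0' : (0 : ℝ) ≤ ⌊(N : ℝ) * t⌋ := by exact_mod_cast a0
    have a1' : (⌊(N : ℝ) * t⌋ : ℝ) < N := by exact_mod_cast a1
    refine hh _ _ (by positivity) ((div_lt_one hN').2 a1') t0 t1 ?_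
    rw [mul_div_cancel₀ _ hN'.ne', Int.floor_intCast]
  have hm : Measurable fun t : ℝ => F ⌊(N : ℝ) * t⌋ :=
    (measurable_from_top (f := F)).comp (Int.measurable_floor.comp (measurable_const.mul measurable_id))
  refine IntegrableOn.congr_fun (f := fun t : ℝ => F ⌊(N : ℝ) * t⌋) ?_ hF measurableSet_Ico
  refine Measure.integrableOn_of_bounded (M := ∑ p ∈ Finset.range N, ‖F p‖) (by simp)
    hm.aestronglyMeasurable ?_
  refine (ae_restrict_iff' measurableSet_Ico).2 (Filter.Eventually.of_forall ?_)
  rintro t ⟨t0, t1⟩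
  obtain ⟨a0, a1⟩ := gtt_floor_bound N hN t t0 t1
  obtain ⟨p, hp⟩ := Int.eq_ofNat_of_zero_le a0
  rw [hp] at a1 ⊢
  exact Finset.single_le_sum (f := fun p : ℕ => ‖F p‖) (fun _ _ => norm_nonneg _)
    (Finset.mem_range.2 (by exact_mod_cast a1))

/-- exact GTT-Fourier reconstruction of piecewise-constant functions.
If `g : [0,1) → ℂ` is constant on each subinterval `[p/N, (p+1)/N)`, `N = bⁿ`,
and `C_m = ∫₀¹ conj (φ_m^{(N)} t) * g t dt`, then for every `x ∈ [0,1)`,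
`g x = Σ_{m<N} C_m * φ_m^{(N)} x`. -/
theorem gtt_fourier_series_exact
    (b : ℕ) (hb : 2 ≤ b) (W : ℕ → ℕ → ℂ)
    (hW : ∀ j < b, ∀ k < b,
      (∑ m ∈ Finset.range b, star (W m j) * W m k) = if j = k then 1 else 0)
    (n : ℕ) (g : ℝ → ℂ)
    (hg : ∀ p < b ^ n, ∀ x y : ℝ,
      (p : ℝ) / (b : ℝ) ^ n ≤ x → x < ((p : ℝ) + 1) / (b : ℝ) ^ n →
      (p : ℝ) / (b : ℝ) ^ n ≤ y → y < ((p : ℝ) + 1) / (b : ℝ) ^ n →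
      g x = g y) :
    ∀ x : ℝ, 0 ≤ x → x < 1 →
      g x = ∑ m ∈ Finset.range (b ^ n),
        (∫ t in (0:ℝ)..1, star (gttNorm b W n m t) * g t) * gttNorm b W n m x := by
  intro x x0 x1
  have hb0 : 0 < b := by omega
  have hN : 0 < b ^ n := pow_pos hb0 n
  have hN' : (0 : ℝ) < ((b ^ n : ℕ) : ℝ) := by exact_mod_cast hN
  have hcast : ((b : ℝ) ^ n) = ((b ^ n : ℕ) : ℝ) := by push_cast; rfl
  have hgs : ∀ t y : ℝ, 0 ≤ t → t < 1 → 0 ≤ y → y < 1 →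
      ⌊((b ^ n : ℕ) : ℝ) * t⌋ = ⌊((b ^ n : ℕ) : ℝ) * y⌋ → g t = g y := by
    intro t y t0 t1 y0 y1 h
    obtain ⟨a0, a1⟩ := gtt_floor_bound (b ^ n) hN t t0 t1
    obtain ⟨p, hp⟩ := Int.eq_ofNat_of_zero_le a0
    have hp2 := h.symm.trans hp
    rw [hp] at a1
    rw [Int.floor_eq_iff] at hp hp2
    push_cast at hp hp2
    rw [hcast] at hp hp2
    refine hg p (by exact_mod_cast a1) t y ?_ ?_ ?_ ?_ <;> rw [hcast]
    · rw [div_le_iff₀ hN']; linarith [hp.1]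
    · rw [lt_div_iff₀ hN']; linarith [hp.2]
    · rw [div_le_iff₀ hN']; linarith [hp2.1]
    · rw [lt_div_iff₀ hN']; linarith [hp2.2]
  have hint : ∀ m, IntegrableOn (fun t => star (gttNorm b W n m t) * g t) (Set.Ico 0 1) := by
    intro m
    refine gtt_integrable (b ^ n) hN _ ?_
    intro t y t0 t1 y0 y1 h
    simp only [gttNorm]
    rw [hgs t y t0 t1 y0 y1 h, gtt_step b hb W n m t y t0 t1 y0 y1 h]
  simp_rw [intervalIntegral.integral_of_le zero_le_one, ← integral_Ico_eq_integral_Ioc,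
    ← integral_mul_const]
  rw [← integral_finsetSum _ (fun m _ => (hint m).mul_const _)]
  obtain ⟨a0, a1⟩ := gtt_floor_bound (b ^ n) hN x x0 x1
  obtain ⟨p, hp⟩ := Int.eq_ofNat_of_zero_le a0
  rw [hp] at a1
  have a1' : (p : ℝ) + 1 ≤ ((b ^ n : ℕ) : ℝ) := by
    have : p + 1 ≤ b ^ n := by exact_mod_cast a1
    exact_mod_cast this
  have hsub : Set.Ico ((p : ℝ) / ((b ^ n : ℕ) : ℝ)) (((p : ℝ) + 1) / ((b ^ n : ℕ) : ℝ)) ⊆ Set.Ico 0 1 := by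
    refine Set.Ico_subset_Ico (by positivity) ((div_le_one hN').2 a1')
  have hsq : ((Real.sqrt ((b : ℝ) ^ n) : ℝ) : ℂ) * (Real.sqrt ((b : ℝ) ^ n) : ℝ) = ((b ^ n : ℕ) : ℂ) := by
    rw [← Complex.ofReal_mul, Real.mul_self_sqrt (by positivity)]; push_cast; rfl
  have hEq : Set.EqOn (fun t => ∑ m ∈ Finset.range (b ^ n),
        star (gttNorm b W n m t) * g t * gttNorm b W n m x)
      (Set.indicator (Set.Ico ((p : ℝ) / ((b ^ n : ℕ) : ℝ)) (((p : ℝ) + 1) / ((b ^ n : ℕ) : ℝ)))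
        fun _ => ((b ^ n : ℕ) : ℂ) * g x) (Set.Ico 0 1) := by
    rintro t ⟨t0, t1⟩
    have hk := gtt_kernel b hb W hW n t x t0 t1 x0 x1
    have e : ∑ m ∈ Finset.range (b ^ n), star (gttNorm b W n m t) * g t * gttNorm b W n m x
        = ((b ^ n : ℕ) : ℂ) * g t *
          ∑ m ∈ Finset.range (b ^ n), star (gtt b W n m t) * gtt b W n m x := by
      rw [Finset.mul_sum]
      refine Finset.sum_congr rfl fun m _ => ?_
      have hs : star ((Real.sqrt ((b : ℝ) ^ n) : ℝ) : ℂ) = (Real.sqrt ((b : ℝ) ^ n) : ℝ) :=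
        Complex.conj_ofReal _
      rw [← hsq, gttNorm, gttNorm, star_mul', hs]
      ring
    have hmem : t ∈ Set.Ico ((p : ℝ) / ((b ^ n : ℕ) : ℝ)) (((p : ℝ) + 1) / ((b ^ n : ℕ) : ℝ)) ↔
        ⌊((b ^ n : ℕ) : ℝ) * t⌋ = ⌊((b ^ n : ℕ) : ℝ) * x⌋ := by
      rw [hp, Int.floor_eq_iff, Set.mem_Ico, div_le_iff₀ hN', lt_div_iff₀ hN', mul_comm t]
      simp
    simp only [e, hk]
    by_cases h : ⌊((b ^ n : ℕ) : ℝ) * t⌋ = ⌊((b ^ n : ℕ) : ℝ) * x⌋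
    · rw [Set.indicator_of_mem (hmem.2 h), if_pos h, hgs t x t0 t1 x0 x1 h, mul_one]
    · rw [Set.indicator_of_notMem (fun h' => h (hmem.1 h')), if_neg h, mul_zero]
  rw [setIntegral_congr_fun measurableSet_Ico hEq, setIntegral_indicator measurableSet_Ico,
    Set.inter_eq_right.2 hsub, setIntegral_const]
  have hv : volume.real (Set.Ico ((p : ℝ) / ((b ^ n : ℕ) : ℝ)) (((p : ℝ) + 1) / ((b ^ n : ℕ) : ℝ)))
      = (((b ^ n : ℕ) : ℝ))⁻¹ := by
    rw [Real.volume_real_Ico_of_le (by gcongr; linarith)]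
    field_simp
    ring
  have hNC : ((b ^ n : ℕ) : ℂ) ≠ 0 := by exact_mod_cast hN.ne'
  rw [hv, Complex.real_smul, Complex.ofReal_inv, Complex.ofReal_natCast, ← mul_assoc,
    inv_mul_cancel₀ hNC, one_mul]
end
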